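/- (Inverse function theorem in Denjoy–Carleman classes, Komatsu) Let (M_j)_{j≥0} be a regular weight sequence, Ω₁, Ω₂ ⊆ ℝⁿ open, F : Ω₁ → Ω₂ an E_M-mapping, and p₀ ∈ Ω₁ a point at which the Jacobian matrix F′(p₀) is invertible. Then there exist open neighbourhoods U of p₀ in Ω₁ and V of q₀ = F(p₀) in Ω₂ and an E_M-mapping G : V → U with G(q₀) = p₀ and F(G(y)) = y for all y ∈ V. -/

import Mathlib

open scoped Topology
open Filter

/-- `m_j = M_j / j!`. -/
noncomputable def mseq (M : ℕ → ℝ) (j : ℕ) : ℝ := M j / (Nat.factorial j : ℝ)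

/-- A weight sequence: positive, normalized `M 0 = 1`, log-convex. -/
structure IsWeightSeq (M : ℕ → ℝ) : Prop where
  pos : ∀ j, 0 < M j
  one : M 0 = 1
  logConvex : ∀ j : ℕ, 1 ≤ j → (M j) ^ 2 ≤ M (j - 1) * M (j + 1)

/-- Condition (M2): `sup_k (m_{k+1}/m_k)^(1/k) < ∞`. -/
def CondM2 (M : ℕ → ℝ) : Prop :=
  ∃ C : ℝ, ∀ k : ℕ, 1 ≤ k → (mseq M (k + 1) / mseq M k) ^ ((1 : ℝ) / k) ≤ C

/-- Condition (M3): log-convexity of `m_k`. -/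
def CondM3 (M : ℕ → ℝ) : Prop :=
  ∀ k : ℕ, 1 ≤ k → (mseq M k) ^ 2 ≤ mseq M (k - 1) * mseq M (k + 1)

/-- Condition (M4): `m_k^(1/k) → ∞`. -/
def CondM4 (M : ℕ → ℝ) : Prop :=
  Filter.Tendsto (fun k : ℕ => (mseq M k) ^ ((1 : ℝ) / k)) Filter.atTop Filter.atTop

/-- A regular weight sequence. -/
structure IsRegularWeightSeq (M : ℕ → ℝ) extends IsWeightSeq M : Prop where
  m_one : mseq M 1 = 1
  cond2 : CondM2 M
  cond3 : CondM3 M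
  cond4 : CondM4 M

/-- The associated weight `h_M(t) = inf_k t^k m_k`. -/
noncomputable def weight_h (M : ℕ → ℝ) (t : ℝ) : ℝ := ⨅ k : ℕ, t ^ k * mseq M k

/-- The associated weight function `ω_M(t) = sup_j log (t^j / M_j)`. -/
noncomputable def weight_omega (M : ℕ → ℝ) (t : ℝ) : ℝ := ⨆ j : ℕ, Real.log (t ^ j / M j)

/-- Membership in the Denjoy-Carleman class `E_M(Ω)`: smooth on `Ω` and on every
compact `K ⊆ Ω` the iterated derivatives satisfy `‖D^k f‖ ≤ C h^k M_k`. -/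
def MemDC (M : ℕ → ℝ) {n : ℕ} {E : Type*} [NormedAddCommGroup E] [NormedSpace ℝ E]
    (Ω : Set (Fin n → ℝ)) (f : (Fin n → ℝ) → E) : Prop :=
  ContDiffOn ℝ (⊤ : ℕ∞) f Ω ∧
  ∀ K : Set (Fin n → ℝ), K ⊆ Ω → IsCompact K →
    ∃ C > 0, ∃ h > 0, ∀ k : ℕ, ∀ x ∈ K,
      ‖iteratedFDerivWithin ℝ k f Ω x‖ ≤ C * h ^ k * M k

namespace OrderedFinpartition

lemma sum_partSize {n : ℕ} (c : OrderedFinpartition n) : ∑ m, c.partSize m = n := by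
  simpa using c.sum_sigma_eq_sum (fun _ => (1 : ℕ))

/-- The ordered finpartition of `Fin n` with a single part. -/
def indiscrete (n : ℕ) (hn : 0 < n) : OrderedFinpartition n where
  length := 1
  partSize _ := n
  partSize_pos _ := hn
  emb _ := id
  emb_strictMono _ := strictMono_id
  parts_strictMono := Subsingleton.strictMono _
  disjoint _ _ _ _ h := (h (Subsingleton.elim _ _)).elim
  cover x := ⟨0, x, rfl⟩

lemma eq_indiscrete {n : ℕ} (hn : 0 < n) (c : OrderedFinpartition n) (hc : c.length = 1) :
    c = indiscrete n hn := by
  have hs := c.sum_partSize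
  obtain ⟨l, ps, h1, e, h2, h3, h4, h5⟩ := c
  dsimp only at hc hs
  subst hc
  have hps : ps = fun _ => n := by
    funext i
    rw [Fin.sum_univ_one] at hs
    rw [Subsingleton.elim i 0, hs]
  subst hps
  have he : e = fun _ => id := by
    funext i
    have h := Subsingleton.elim (α := Fin n ≃o Fin n)
      (StrictMono.orderIsoOfSurjective (e i) (h2 i)
        (Finite.surjective_of_injective (h2 i).injective)) (OrderIso.refl _)
    funext x
    exact congrArg (fun f : Fin n ≃o Fin n => f x) h
  subst he
  rfl

lemma partSize_lt {n : ℕ} (hn : 0 < n) {c : OrderedFinpartition n} (hc : c ≠ indiscrete n hn)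
    (m : Fin c.length) : c.partSize m < n := by
  refine lt_of_le_of_ne (c.partSize_le m) fun h => hc (c.eq_indiscrete hn ?_)
  have hs := c.sum_partSize
  rw [← Finset.add_sum_erase _ _ (Finset.mem_univ m), h] at hs
  have h0 : ∑ i ∈ Finset.univ.erase m, c.partSize i = 0 := by omega
  have he : Finset.univ.erase m = ∅ := by
    by_contra hne
    obtain ⟨i, hi⟩ := Finset.nonempty_iff_ne_empty.mpr hne
    have := c.partSize_pos i
    have := (Finset.sum_eq_zero_iff.mp h0) i hi
    omega
  have := congrArg Finset.card he
  rw [Finset.card_erase_of_mem (Finset.mem_univ m)] at this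
  have := c.length_pos hn
  simp at *
  omega

end OrderedFinpartition

lemma mseq_pos {M : ℕ → ℝ} (hM : IsWeightSeq M) (k : ℕ) : 0 < mseq M k :=
  div_pos (hM.pos k) (by positivity)

lemma mseq_ratio_monotone {M : ℕ → ℝ} (hM : IsWeightSeq M) (h3 : CondM3 M) :
    Monotone fun k => mseq M (k + 1) / mseq M k := by
  refine monotone_nat_of_le_succ fun k => ?_
  rw [div_le_div_iff₀ (mseq_pos hM _) (mseq_pos hM _)]
  have := h3 (k + 1) (by omega)
  simp only [Nat.add_sub_cancel] at this
  nlinarith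

lemma mseq_succ_mul_mul_le {M : ℕ → ℝ} (hM : IsWeightSeq M) (h1 : mseq M 1 = 1) (h3 : CondM3 M)
    {j K l : ℕ} (hjK : j ≤ K) (hl : 1 ≤ l) :
    mseq M (j + 1) / mseq M j * (mseq M l * mseq M K) ≤ mseq M (K + l) := by
  induction l, hl using Nat.le_induction with
  | base =>
    have := mseq_ratio_monotone hM h3 hjK
    dsimp only at this
    rwa [h1, one_mul, ← le_div_iff₀ (mseq_pos hM _)]
  | succ l hl ih =>
    have hr := mseq_ratio_monotone hM h3 (show l ≤ K + l by omega)
    dsimp only at hr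
    have e1 : mseq M (l + 1) = mseq M (l + 1) / mseq M l * mseq M l :=
      (div_mul_cancel₀ _ (mseq_pos hM _).ne').symm
    have e2 : mseq M (K + (l + 1)) = mseq M (K + l + 1) / mseq M (K + l) * mseq M (K + l) :=
      (div_mul_cancel₀ _ (mseq_pos hM _).ne').symm
    rw [e2, e1]
    calc _ = mseq M (l + 1) / mseq M l * (mseq M (j + 1) / mseq M j * (mseq M l * mseq M K)) := by
            ring
      _ ≤ _ := mul_le_mul hr ih
        (mul_nonneg (div_pos (mseq_pos hM _) (mseq_pos hM _)).le
          (mul_pos (mseq_pos hM _) (mseq_pos hM _)).le)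
        (div_pos (mseq_pos hM _) (mseq_pos hM _)).le

lemma mseq_mul_prod_le {M : ℕ → ℝ} (hM : IsWeightSeq M) (h1 : mseq M 1 = 1) (h3 : CondM3 M)
    (j : ℕ) (s : Fin j → ℕ) (hs : ∀ i, 1 ≤ s i) :
    mseq M j * ∏ i, mseq M (s i) ≤ mseq M (∑ i, s i) := by
  induction j with
  | zero => simp
  | succ j ih =>
    rw [Fin.prod_univ_castSucc, Fin.sum_univ_castSucc]
    have hj : j ≤ ∑ i : Fin j, s i.castSucc := by
      simpa using Finset.sum_le_sum fun (i : Fin j) (_ : i ∈ Finset.univ) => hs i.castSucc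
    refine le_trans ?_ (mseq_succ_mul_mul_le hM h1 h3 hj (hs (Fin.last j)))
    have hi := ih (fun i => s i.castSucc) (fun i => hs _)
    have e1 : mseq M (j + 1) = mseq M (j + 1) / mseq M j * mseq M j :=
      (div_mul_cancel₀ _ (mseq_pos hM _).ne').symm
    calc _ = mseq M (j + 1) / mseq M j * (mseq M (s (Fin.last j)) *
          (mseq M j * ∏ i : Fin j, mseq M (s i.castSucc))) := by
            conv_lhs => rw [e1]
            ring
      _ ≤ _ := by
        have := (div_pos (mseq_pos hM (j + 1)) (mseq_pos hM j)).le
        have := (mseq_pos hM (s (Fin.last j))).le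
        gcongr

lemma iteratedDeriv_mul_inv_one_sub (D h : ℝ) (k : ℕ) :
    iteratedDeriv k (fun x : ℝ => D * (1 - h * x)⁻¹) 0 = D * h ^ k * k.factorial := by
  have := congrFun (iter_deriv_inv_linear k (-h) (1 : ℝ)) 0
  rw [iteratedDeriv_const_mul_field, iteratedDeriv_eq_iterate]
  have e : (fun x : ℝ => (1 - h * x)⁻¹) = fun x => (-h * x + 1)⁻¹ := by
    funext x; ring_nf
  rw [e, this]
  have : ((-1 : ℝ) ^ k) * (-1) ^ k = 1 := by rw [← mul_pow]; simp
  simp only [mul_zero, zero_add, one_zpow, mul_one, neg_pow h]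
  linear_combination D * k.factorial * h ^ k * this

lemma exists_majorant_sequence {A D h : ℝ} (hA : 0 < A) (hD : 0 < D) (hh : 0 < h) :
    ∃ b : ℕ → ℝ, (∀ k, 0 ≤ b k) ∧ b 1 = A ∧
      (∀ k (hk : 2 ≤ k),
        ∑ c ∈ Finset.univ.erase (OrderedFinpartition.indiscrete k (by omega)),
          D * h ^ c.length * c.length.factorial * ∏ i, b (c.partSize i) = b k) ∧
      ∃ C > 0, ∃ r > 0, ∀ k, b k ≤ C * r ^ k * k.factorial := by
  let u : ℝ → ℝ := fun x => D * (1 - h * x)⁻¹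
  have hu : ContDiffAt ℝ ⊤ u 0 := by
    refine contDiffAt_const.mul (ContDiffAt.inv (by fun_prop) (by simp))
  have hu' : HasDerivAt u (D * h) 0 := by
    have := hu.differentiableAt (by simp) |>.hasDerivAt
    have h2 := iteratedDeriv_mul_inv_one_sub D h 1
    rw [iteratedDeriv_one] at h2
    rw [h2] at this
    simpa using this
  let ψ : ℝ → ℝ := fun x => x + D * h * x + D - u x
  have hψ : ContDiffAt ℝ ⊤ ψ 0 := by
    refine ContDiffAt.sub (by fun_prop) hu
  have hψ' : HasDerivAt ψ 1 0 := by
    have := (((hasDerivAt_id (0 : ℝ)).add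
      ((hasDerivAt_id (0 : ℝ)).const_mul (D * h))).add_const D).sub hu'
    simpa [ψ] using! this
  have hψe : HasFDerivAt ψ ((ContinuousLinearEquiv.refl ℝ ℝ : ℝ ≃L[ℝ] ℝ) : ℝ →L[ℝ] ℝ) 0 := by
    have e : ((ContinuousLinearEquiv.refl ℝ ℝ : ℝ ≃L[ℝ] ℝ) : ℝ →L[ℝ] ℝ) =
        ContinuousLinearMap.toSpanSingleton ℝ 1 := by
      ext; simp
    rw [e]
    exact hψ'.hasFDerivAt
  have hψ0 : ψ 0 = 0 := by simp [ψ, u]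
  let g₀ := hψ.localInverse hψe (by simp)
  have hg₀ : ContDiffAt ℝ ⊤ g₀ 0 := hψ0 ▸ hψ.to_localInverse hψe (by simp)
  have hg₀0 : g₀ 0 = 0 := by
    have := hψ.localInverse_apply_image hψe (by simp)
    rwa [hψ0] at this
  have hg₀i : ∀ᶠ y in 𝓝 0, ψ (g₀ y) = y := by
    have := (hψ.hasStrictFDerivAt' hψe (by simp)).eventually_right_inverse
    rwa [hψ0] at this
  let g : ℝ → ℝ := fun t => g₀ (A * t)
  have hg : ContDiffAt ℝ ⊤ g 0 := by
    have : ContDiffAt ℝ ⊤ g₀ (A * 0) := by rwa [mul_zero]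
    exact this.comp (0 : ℝ) (f := fun t : ℝ => A * t) (by fun_prop)
  have hg0 : g 0 = 0 := by simp [g, hg₀0]
  have hgi : ∀ᶠ t in 𝓝 (0 : ℝ), ψ (g t) = A * t := by
    have ht : Tendsto (fun t : ℝ => A * t) (𝓝 0) (𝓝 0) := by
      have : ContinuousAt (fun t : ℝ => A * t) 0 := by fun_prop
      simpa [ContinuousAt] using this
    exact ht.eventually hg₀i
  have hev : (u ∘ g) =ᶠ[𝓝 0] fun t => (1 + D * h) * g t + (D - A * t) := by
    filter_upwards [hgi] with t ht
    simp only [ψ] at ht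
    simp only [Function.comp]
    linear_combination -ht
  let b : ℕ → ℝ := fun k => iteratedDeriv k g 0
  have hb0 : b 0 = 0 := by simp [b, hg0]
  have hb1 : b 1 = A := by
    have h1 : HasDerivAt (ψ ∘ g) (1 * b 1) 0 := by
      refine HasDerivAt.comp (0 : ℝ) (by rwa [hg0]) ?_
      simpa [b, iteratedDeriv_one] using (hg.differentiableAt (by simp)).hasDerivAt
    have h2 : HasDerivAt (ψ ∘ g) A 0 := by
      refine HasDerivAt.congr_of_eventuallyEq ?_ hgi
      simpa using (hasDerivAt_id (0 : ℝ)).const_mul A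
    linarith [h1.unique h2]
  have hrec : ∀ k (hk : 2 ≤ k),
        ∑ c ∈ Finset.univ.erase (OrderedFinpartition.indiscrete k (by omega)),
          D * h ^ c.length * c.length.factorial * ∏ i, b (c.partSize i) = b k := by
    intro k hk
    have e1 : iteratedDeriv k (u ∘ g) 0 = (1 + D * h) * b k := by
      rw [hev.iteratedDeriv_eq]
      have hl : iteratedDeriv k (fun t : ℝ => D - A * t) 0 = 0 := by
        obtain ⟨k, rfl⟩ := Nat.exists_eq_add_of_le' hk
        rw [iteratedDeriv_succ', iteratedDeriv_succ']
        have : deriv (fun t : ℝ => D - A * t) = fun _ => -A := by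
          funext t
          simp
        rw [this]
        simp
      have := iteratedDeriv_fun_add (n := k) (x := (0 : ℝ)) (f := fun t => (1 + D * h) * g t)
        (g := fun t => D - A * t)
        ((contDiffAt_const.mul hg).of_le le_top) (by fun_prop)
      rw [this, hl, add_zero, iteratedDeriv_const_mul_field]
    rw [iteratedDeriv_comp_eq_sum_orderedFinpartition (n := ⊤) (by rwa [hg0]) hg le_top] at e1
    rw [← Finset.add_sum_erase _ _
      (Finset.mem_univ (OrderedFinpartition.indiscrete k (by omega)))] at e1
    simp only [hg0, u, iteratedDeriv_mul_inv_one_sub] at e1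
    have e2 : ∏ j, iteratedDeriv ((OrderedFinpartition.indiscrete k (by omega)).partSize j) g 0
        = b k := by
      change ∏ _j : Fin 1, iteratedDeriv k g 0 = iteratedDeriv k g 0
      simp
    rw [e2] at e1
    simp only [OrderedFinpartition.indiscrete, pow_one, Nat.factorial_one, Nat.cast_one,
      mul_one] at e1
    simp only [OrderedFinpartition.indiscrete, b] at e1 ⊢
    linear_combination e1
  refine ⟨b, ?_, hb1, hrec, ?_⟩
  · intro k
    induction k using Nat.strong_induction_on with
    | _ k ih =>
      match k, ih with
      | 0, _ => exact hb0.ge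
      | 1, _ => rw [hb1]; exact hA.le
      | k + 2, ih =>
        rw [← hrec (k + 2) (by omega)]
        refine Finset.sum_nonneg fun c hc => mul_nonneg (by positivity) ?_
        exact Finset.prod_nonneg fun i _ => ih _
          (OrderedFinpartition.partSize_lt (by omega) (Finset.ne_of_mem_erase hc) i)
  · have hp := (hg.analyticAt).hasFPowerSeriesAt
    obtain ⟨C, r, hC, hr, hbd⟩ := FormalMultilinearSeries.le_mul_pow_of_radius_pos _ hp.radius_pos
    refine ⟨C, hC, r, hr, fun k => ?_⟩
    have := hbd k
    rw [FormalMultilinearSeries.ofScalars_norm] at this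
    have hk : (0 : ℝ) < k.factorial := by positivity
    rw [norm_div, Real.norm_of_nonneg hk.le, div_le_iff₀ hk] at this
    exact (le_abs_self _).trans this

lemma norm_iteratedFDeriv_rightInverse_le {M : ℕ → ℝ} (hM : IsWeightSeq M) (h1 : mseq M 1 = 1)
    (h3 : CondM3 M) {E : Type*} [NormedAddCommGroup E] [NormedSpace ℝ E] {F G : E → E} {y : E}
    (hF : ContDiffAt ℝ (⊤ : ℕ∞) F (G y)) (hG : ContDiffAt ℝ (⊤ : ℕ∞) G y)
    (hFG : F ∘ G =ᶠ[𝓝 y] id)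
    (hinv : ∀ v, fderiv ℝ G y (fderiv ℝ F (G y) v) = v)
    {A C h : ℝ} (hA : ‖fderiv ℝ G y‖ ≤ A) (hC : 0 < C) (hh : 0 < h)
    (hbd : ∀ j, ‖iteratedFDeriv ℝ j F (G y)‖ ≤ C * h ^ j * M j)
    {b : ℕ → ℝ} (hb : ∀ k, 0 ≤ b k) (hb1 : A ≤ b 1)
    (hrec : ∀ k (hk : 2 ≤ k),
      ∑ c ∈ Finset.univ.erase (OrderedFinpartition.indiscrete k (by omega)),
        A * C * h ^ c.length * c.length.factorial * ∏ i, b (c.partSize i) ≤ b k)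
    (k : ℕ) (hk : 1 ≤ k) : ‖iteratedFDeriv ℝ k G y‖ ≤ mseq M k * b k := by
  have hA0 : 0 ≤ A := (norm_nonneg _).trans hA
  induction k using Nat.strong_induction_on with
  | _ k ih =>
    obtain rfl | hk2 : k = 1 ∨ 2 ≤ k := by omega
    · rw [h1, one_mul, norm_iteratedFDeriv_one]
      exact hA.trans hb1
    have hk0 : 0 < k := by omega
    let c₀ := OrderedFinpartition.indiscrete k hk0
    let q := ftaylorSeries ℝ F (G y)
    let p := ftaylorSeries ℝ G y
    have hcomp : iteratedFDeriv ℝ k (F ∘ G) y = 0 := by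
      rw [hFG.iteratedFDeriv ℝ k |>.eq_of_nhds]
      obtain ⟨k, rfl⟩ := Nat.exists_eq_add_of_le' hk2
      ext v
      rw [iteratedFDeriv_succ_apply_right]
      have : fderiv ℝ (id : E → E) = fun _ => ContinuousLinearMap.id ℝ E := by
        funext x; exact fderiv_id
      rw [this, iteratedFDeriv_const_of_ne (by omega)]
      simp
    rw [iteratedFDeriv_comp hF hG (i := k) (by exact_mod_cast le_top)] at hcomp
    have hsum : q.compAlongOrderedFinpartition p c₀ +
        ∑ c ∈ Finset.univ.erase c₀, q.compAlongOrderedFinpartition p c = 0 := by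
      rw [Finset.add_sum_erase _ _ (Finset.mem_univ c₀)]
      exact hcomp
    have heq : iteratedFDeriv ℝ k G y = -((fderiv ℝ G y).compContinuousMultilinearMap
        (∑ c ∈ Finset.univ.erase c₀, q.compAlongOrderedFinpartition p c)) := by
      rw [← neg_eq_of_add_eq_zero_right hsum]
      ext v
      have hv : q.compAlongOrderedFinpartition p c₀ v =
          fderiv ℝ F (G y) (iteratedFDeriv ℝ k G y v) := by
        exact iteratedFDeriv_one_apply (𝕜 := ℝ) (f := F) (x := G y)
          (fun _ : Fin 1 => iteratedFDeriv ℝ k G y v)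
      simp [hv, hinv]
    rw [heq, norm_neg]
    refine (ContinuousLinearMap.norm_compContinuousMultilinearMap_le _ _).trans ?_
    have hterm : ∀ c ∈ Finset.univ.erase c₀, ‖q.compAlongOrderedFinpartition p c‖ ≤
        mseq M k * (C * h ^ c.length * c.length.factorial * ∏ i, b (c.partSize i)) := by
      intro c hc
      have hprod : ∏ i, ‖p (c.partSize i)‖ ≤ ∏ i, (mseq M (c.partSize i) * b (c.partSize i)) :=
        Finset.prod_le_prod (fun _ _ => norm_nonneg _) fun i _ =>
          ih _ (OrderedFinpartition.partSize_lt hk0 (Finset.ne_of_mem_erase hc) i)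
            (c.partSize_pos i)
      have hm := mseq_mul_prod_le hM h1 h3 c.length c.partSize c.partSize_pos
      rw [c.sum_partSize] at hm
      have hbp : 0 ≤ ∏ i, b (c.partSize i) := Finset.prod_nonneg fun i _ => hb _
      have hMl : M c.length = mseq M c.length * c.length.factorial :=
        (div_mul_cancel₀ _ (by positivity)).symm
      have hM0 := (hM.pos c.length).le
      calc ‖q.compAlongOrderedFinpartition p c‖ ≤ ‖q c.length‖ * ∏ i, ‖p (c.partSize i)‖ :=
            c.norm_compAlongOrderedFinpartition_le _ _
        _ ≤ (C * h ^ c.length * M c.length) *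
              ∏ i, (mseq M (c.partSize i) * b (c.partSize i)) :=
            mul_le_mul (hbd _) hprod (Finset.prod_nonneg fun _ _ => norm_nonneg _)
              (by positivity)
        _ = (mseq M c.length * ∏ i, mseq M (c.partSize i)) *
              (C * h ^ c.length * c.length.factorial * ∏ i, b (c.partSize i)) := by
            rw [Finset.prod_mul_distrib, hMl]; ring
        _ ≤ _ := by gcongr
    calc ‖fderiv ℝ G y‖ * ‖∑ c ∈ Finset.univ.erase c₀, q.compAlongOrderedFinpartition p c‖
        ≤ A * ∑ c ∈ Finset.univ.erase c₀,
          mseq M k * (C * h ^ c.length * c.length.factorial * ∏ i, b (c.partSize i)) := by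
          gcongr
          exact (norm_sum_le _ _).trans (Finset.sum_le_sum hterm)
      _ = mseq M k * ∑ c ∈ Finset.univ.erase c₀,
          A * C * h ^ c.length * c.length.factorial * ∏ i, b (c.partSize i) := by
          rw [Finset.mul_sum, Finset.mul_sum]
          exact Finset.sum_congr rfl fun c _ => by ring
      _ ≤ mseq M k * b k := by
          have := (mseq_pos hM k).le
          gcongr
          exact hrec k hk2

lemma norm_iteratedFDeriv_apply_le {n m k : ℕ} {f : (Fin n → ℝ) → (Fin m → ℝ)} {x : Fin n → ℝ}
    (hf : ContDiffAt ℝ k f x) (i : Fin m) :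
    ‖iteratedFDeriv ℝ k (fun x => f x i) x‖ ≤ ‖iteratedFDeriv ℝ k f x‖ := by
  have := (ContinuousLinearMap.proj (R := ℝ) (φ := fun _ : Fin m => ℝ) i).iteratedFDeriv_comp_left
    hf (i := k) le_rfl
  change iteratedFDeriv ℝ k (fun x => f x i) x = _ at this
  rw [this]
  refine ContinuousMultilinearMap.opNorm_le_bound (norm_nonneg _) fun v => ?_
  exact (norm_le_pi_norm (iteratedFDeriv ℝ k f x v) i).trans
    (ContinuousMultilinearMap.le_opNorm _ _)

lemma norm_iteratedFDeriv_le_of_apply {n m k : ℕ} {f : (Fin n → ℝ) → (Fin m → ℝ)} {x : Fin n → ℝ}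
    (hf : ContDiffAt ℝ k f x) {B : ℝ} (hB : 0 ≤ B)
    (h : ∀ i, ‖iteratedFDeriv ℝ k (fun x => f x i) x‖ ≤ B) :
    ‖iteratedFDeriv ℝ k f x‖ ≤ B := by
  refine ContinuousMultilinearMap.opNorm_le_bound hB fun v => ?_
  refine (pi_norm_le_iff_of_nonneg (by positivity)).mpr fun i => ?_
  have := (ContinuousLinearMap.proj (R := ℝ) (φ := fun _ : Fin m => ℝ) i).iteratedFDeriv_comp_left
    hf (i := k) le_rfl
  change iteratedFDeriv ℝ k (fun x => f x i) x = _ at this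
  have h2 := (iteratedFDeriv ℝ k (fun x => f x i) x).le_of_opNorm_le (h i) v
  rwa [this] at h2

lemma exists_norm_iteratedFDeriv_le_of_memDC {M : ℕ → ℝ} (hM : IsWeightSeq M) {n m : ℕ}
    {Ω K : Set (Fin n → ℝ)} (hΩ : IsOpen Ω) {F : (Fin n → ℝ) → (Fin m → ℝ)}
    (hF : ∀ i, MemDC M Ω (fun x => F x i)) (hKΩ : K ⊆ Ω) (hK : IsCompact K) :
    ∃ C > 0, ∃ h > 0, ∀ k : ℕ, ∀ x ∈ K, ‖iteratedFDeriv ℝ k F x‖ ≤ C * h ^ k * M k := by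
  choose C hC h hh hbd using fun i => (hF i).2 K hKΩ hK
  have hCs : ∀ i, C i ≤ ∑ i, C i + 1 := fun i => by
    linarith [Finset.single_le_sum (fun i _ => (hC i).le) (Finset.mem_univ i)]
  have hhs : ∀ i, h i ≤ ∑ i, h i + 1 := fun i => by
    linarith [Finset.single_le_sum (fun i _ => (hh i).le) (Finset.mem_univ i)]
  have hC0 : 0 < ∑ i, C i + 1 := by
    linarith [Finset.sum_nonneg fun i (_ : i ∈ Finset.univ) => (hC i).le]
  have hh0 : 0 < ∑ i, h i + 1 := by
    linarith [Finset.sum_nonneg fun i (_ : i ∈ Finset.univ) => (hh i).le]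
  refine ⟨_, hC0, _, hh0, fun k x hx => ?_⟩
  have hM0 := (hM.pos k).le
  refine norm_iteratedFDeriv_le_of_apply ?_ (by positivity) fun i => ?_
  · refine contDiffAt_pi.mpr fun i => ?_
    exact ((hF i).1.contDiffAt (hΩ.mem_nhds (hKΩ hx))).of_le (by exact_mod_cast le_top)
  · rw [← iteratedFDerivWithin_of_isOpen k hΩ (hKΩ hx)]
    refine (hbd i k x hx).trans ?_
    have := (hC i).le
    have := (hh i).le
    gcongr
    · exact hCs i
    · exact hhs i

/-- A smooth map with invertible derivative at a point has a smooth local right inverse with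
uniformly bounded derivative, whose values stay in a prescribed neighbourhood. -/
lemma exists_smooth_local_rightInverse {E : Type*} [NormedAddCommGroup E] [NormedSpace ℝ E]
    [CompleteSpace E] {F : E → E} {p : E} {W N : Set E} (hW : W ∈ 𝓝 p) (hN : N ∈ 𝓝 (F p))
    (hF : ∀ x ∈ W, ContDiffAt ℝ (⊤ : ℕ∞) F x) (hinv : IsUnit (fderiv ℝ F p)) :
    ∃ (G : E → E) (V : Set E) (A : ℝ), IsOpen V ∧ F p ∈ V ∧ V ⊆ N ∧ G (F p) = p ∧ 0 < A ∧
      ∀ y ∈ V, G y ∈ W ∧ F (G y) = y ∧ ContDiffAt ℝ (⊤ : ℕ∞) G y ∧ ‖fderiv ℝ G y‖ ≤ A ∧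
        ∀ v, fderiv ℝ G y (fderiv ℝ F (G y) v) = v := by
  have hFp := hF p (mem_of_mem_nhds hW)
  have hderiv : ∀ x ∈ W, ∀ hu : IsUnit (fderiv ℝ F x), HasFDerivAt F
      ((ContinuousLinearEquiv.unitsEquiv ℝ E hu.unit : E ≃L[ℝ] E) : E →L[ℝ] E) x :=
    fun x hx hu => ((hF x hx).differentiableAt (by simp)).hasFDerivAt
  let e := hFp.toOpenPartialHomeomorph F (hderiv p (mem_of_mem_nhds hW) hinv) (by simp)
  have hps : p ∈ e.source := hFp.mem_toOpenPartialHomeomorph_source _ _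
  have hpt : F p ∈ e.target := e.map_source hps
  have hep : e.symm (F p) = p := e.left_inv hps
  have hcont : ContinuousAt e.symm (F p) := e.continuousAt_symm hpt
  have hunit : ∀ᶠ x in 𝓝 p, IsUnit (fderiv ℝ F x) := by
    have : ContinuousAt (fderiv ℝ F) p := (hFp.fderiv_right (m := 0) (by simp)).continuousAt
    exact this.eventually (Units.isOpen.mem_nhds hinv)
  have hsmooth : ∀ y ∈ e.target, e.symm y ∈ W → IsUnit (fderiv ℝ F (e.symm y)) →
      ContDiffAt ℝ (⊤ : ℕ∞) e.symm y := fun y hy hyW hu =>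
    e.contDiffAt_symm hy (hderiv _ hyW hu) (hF _ hyW)
  have hGp : ContDiffAt ℝ (⊤ : ℕ∞) e.symm (F p) :=
    hsmooth _ hpt (by rw [hep]; exact mem_of_mem_nhds hW) (by rwa [hep])
  have hbdd : ∀ᶠ y in 𝓝 (F p), ‖fderiv ℝ e.symm y‖ < ‖fderiv ℝ e.symm (F p)‖ + 1 :=
    (hGp.fderiv_right (m := 0) (by simp)).continuousAt.norm.eventually_lt_const (by linarith)
  rw [ContinuousAt, hep] at hcont
  have hall := (e.open_target.eventually_mem hpt).and <| (hcont.eventually hunit).and <|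
    (hcont.eventually hW).and <| hbdd.and hN
  obtain ⟨V, hV, hVo, hpV⟩ := eventually_nhds_iff.mp hall
  refine ⟨e.symm, V, ‖fderiv ℝ e.symm (F p)‖ + 1, hVo, hpV, fun y hy => (hV y hy).2.2.2.2, hep,
    by positivity, fun y hy => ?_⟩
  obtain ⟨hyt, hyu, hyW, hyb, -⟩ := hV y hy
  have hFe : F (e.symm y) = y := e.right_inv hyt
  have hGy := hsmooth y hyt hyW hyu
  refine ⟨hyW, hFe, hGy, hyb.le, fun v => ?_⟩
  have hd1 : HasFDerivAt e.symm (fderiv ℝ e.symm y) (F (e.symm y)) := by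
    rw [hFe]
    exact (hGy.differentiableAt (by simp)).hasFDerivAt
  have hd2 := hd1.comp _ ((hF _ hyW).differentiableAt (by simp)).hasFDerivAt
  have hd3 : HasFDerivAt (e.symm ∘ F) (ContinuousLinearMap.id ℝ E) (e.symm y) :=
    (hasFDerivAt_id _).congr_of_eventuallyEq (e.eventually_left_inverse (e.map_target hyt))
  exact congrArg (fun L : E →L[ℝ] E => L v) (hd2.unique hd3)

/-- The inverse function theorem in Denjoy–Carleman classes (Komatsu). -/
theorem stmt_16 (M : ℕ → ℝ) (hM : IsRegularWeightSeq M)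
    {n : ℕ} (Ω₁ Ω₂ : Set (Fin n → ℝ)) (h1 : IsOpen Ω₁) (h2 : IsOpen Ω₂)
    (F : (Fin n → ℝ) → (Fin n → ℝ)) (hmaps : Set.MapsTo F Ω₁ Ω₂)
    (hF : ∀ i : Fin n, MemDC M Ω₁ (fun x => F x i))
    (p₀ : Fin n → ℝ) (hp₀ : p₀ ∈ Ω₁)
    (hinv : IsUnit (fderiv ℝ F p₀)) :
    ∃ U V : Set (Fin n → ℝ), IsOpen U ∧ IsOpen V ∧ p₀ ∈ U ∧ U ⊆ Ω₁ ∧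
      F p₀ ∈ V ∧ V ⊆ Ω₂ ∧
      ∃ G : (Fin n → ℝ) → (Fin n → ℝ),
        (∀ i : Fin n, MemDC M V (fun y => G y i)) ∧ Set.MapsTo G V U ∧
        G (F p₀) = p₀ ∧ ∀ y ∈ V, F (G y) = y := by
  have hFs : ∀ x ∈ Ω₁, ContDiffAt ℝ (⊤ : ℕ∞) F x := fun x hx =>
    contDiffAt_pi.mpr fun i => (hF i).1.contDiffAt (h1.mem_nhds hx)
  obtain ⟨r, hr, hrΩ⟩ := Metric.nhds_basis_closedBall.mem_iff.mp (h1.mem_nhds hp₀)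
  have hK := isCompact_closedBall p₀ r
  obtain ⟨C, hC, h, hh, hbd⟩ := exists_norm_iteratedFDeriv_le_of_memDC hM.toIsWeightSeq h1 hF hrΩ hK
  obtain ⟨G, V, A, hVo, hpV, hVN, hGp, hA, hG⟩ := exists_smooth_local_rightInverse
    (Metric.closedBall_mem_nhds p₀ hr) (h2.mem_nhds (hmaps hp₀)) (fun x hx => hFs x (hrΩ hx)) hinv
  obtain ⟨b, hb, hb1, hrec, C', hC', s, hs, hbb⟩ :=
    exists_majorant_sequence hA (mul_pos hA hC) hh
  have hGbd : ∀ y ∈ V, ∀ k : ℕ, 1 ≤ k → ‖iteratedFDeriv ℝ k G y‖ ≤ mseq M k * b k :=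
    fun y hy k hk => by
      obtain ⟨hyK, -, hyG, hyA, hyi⟩ := hG y hy
      have hFG : F ∘ G =ᶠ[𝓝 y] id := by
        filter_upwards [hVo.mem_nhds hy] with z hz using (hG z hz).2.1
      exact norm_iteratedFDeriv_rightInverse_le hM.toIsWeightSeq hM.m_one hM.cond3
        (hFs _ (hrΩ hyK)) hyG hFG hyi hyA hC hh (fun j => hbd j _ hyK) hb hb1.ge
        (fun k hk => (hrec k hk).le) k hk
  refine ⟨Ω₁, V, h1, hVo, hp₀, subset_rfl, hpV, hVN, G, fun i => ⟨?_, fun K hKV _ => ?_⟩,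
    fun y hy => hrΩ (hG y hy).1, hGp, fun y hy => (hG y hy).2.1⟩
  · exact fun y hy => (contDiffAt_pi.mp (hG y hy).2.2.1 i).contDiffWithinAt
  · refine ⟨C' + (‖p₀‖ + r), by positivity, s, hs, fun k y hy => ?_⟩
    have hyV := hKV hy
    rw [iteratedFDerivWithin_of_isOpen k hVo hyV]
    refine (norm_iteratedFDeriv_apply_le
      ((hG y hyV).2.2.1.of_le (by exact_mod_cast le_top)) i).trans ?_
    have hM0 := (hM.pos k).le
    have hle : C' * s ^ k * M k ≤ (C' + (‖p₀‖ + r)) * s ^ k * M k := by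
      gcongr
      linarith [norm_nonneg p₀]
    rcases Nat.eq_zero_or_pos k with rfl | hk
    · have hn := norm_le_norm_add_norm_sub' (G y) p₀
      have hd := mem_closedBall_iff_norm.mp (hG y hyV).1
      rw [norm_iteratedFDeriv_zero, hM.one]
      linarith
    · refine ((hGbd y hyV k hk).trans ?_).trans hle
      have hMk : M k = mseq M k * k.factorial := (div_mul_cancel₀ _ (by positivity)).symm
      calc mseq M k * b k ≤ mseq M k * (C' * s ^ k * k.factorial) := by
            have := (mseq_pos hM.toIsWeightSeq k).le
            gcongr
            exact hbb k
        _ = C' * s ^ k * M k := by rw [hMk]; ring
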